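/- Let X be a complex Banach space, (T(t))_{t≥0} a bounded C₀-semigroup on X with M := sup_{t≥0} ‖T(t)‖. For each t > 0 let ν_t be a Borel probability measure on [0,∞) with ∫₀^∞ s dν_t(s) = 1, σ_t² := ∫₀^∞ s² dν_t(s) < ∞ and m_{4,t} := ∫₀^∞ s⁴ dν_t(s) < ∞, and for n ≥ 1 define the bounded operator P_{t,n} on X by P_{t,n} x = ∫₀^∞ T(ts/n) x dν_t(s) (Bochner integral). Suppose x, y₁, y₂, y₃ ∈ X satisfy T(u)x = x − ∫₀ᵘ T(v)y₁ dv, T(u)y₁ = y₁ − ∫₀ᵘ T(v)y₂ dv, and T(u)y₂ = y₂ − ∫₀ᵘ T(v)y₃ dv for all u ≥ 0 (i.e. x ∈ dom(A³) with Aʲx = y_j). Then for all t > 0 and all positive integers n: ‖ P_{t,n}ⁿ x − T(t) x − (σ_t² − 1) t² / (2n) · T(t) y₂ ‖ ≤ M ( (σ_t² − 1)(m_{4,t} − 1)/2 )^{1/2} t³ n^{−3/2} ‖y₃‖. -/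

import Mathlib

open MeasureTheory Real Set Filter

lemma integrable_fun_sub {α E : Type*} [MeasurableSpace α] [NormedAddCommGroup E] {μ : Measure α}
    {f g : α → E} (hf : Integrable f μ) (hg : Integrable g μ) :
    Integrable (fun a => f a - g a) μ :=
  hf.sub hg

/-- The `n`-fold convolution power of a measure: the law of a sum of `n` independent variables. -/
noncomputable def convPow (ν : Measure ℝ) : ℕ → Measure ℝ
  | 0 => Measure.dirac 0
  | n + 1 => (convPow ν n).conv ν

instance convPow_isProbabilityMeasure (ν : Measure ℝ) [IsProbabilityMeasure ν] (n : ℕ) :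
    IsProbabilityMeasure (convPow ν n) := by
  induction n with
  | zero => unfold convPow; infer_instance
  | succ n ih => unfold convPow; infer_instance

lemma ae_nonneg_conv {μ ν : Measure ℝ} [SFinite μ] [SFinite ν]
    (hμ : ∀ᵐ s ∂μ, 0 ≤ s) (hν : ∀ᵐ s ∂ν, 0 ≤ s) : ∀ᵐ s ∂(μ.conv ν), 0 ≤ s := by
  rw [Measure.conv, ae_map_iff (by fun_prop) measurableSet_Ici]
  have h₁ := Measure.quasiMeasurePreserving_fst (μ := μ) (ν := ν) |>.ae hμ
  have h₂ := Measure.quasiMeasurePreserving_snd (μ := μ) (ν := ν) |>.ae hν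
  filter_upwards [h₁, h₂] with z h h' using add_nonneg h h'

lemma ae_nonneg_convPow {ν : Measure ℝ} [IsProbabilityMeasure ν]
    (hν : ∀ᵐ s ∂ν, 0 ≤ s) (n : ℕ) : ∀ᵐ s ∂(convPow ν n), 0 ≤ s := by
  induction n with
  | zero => simp [convPow, ae_dirac_eq]
  | succ n ih => exact ae_nonneg_conv ih hν

lemma integrable_pow_conv {μ ν : Measure ℝ} [IsProbabilityMeasure μ] [IsProbabilityMeasure ν]
    {p q : ℝ} {N : ℕ} (hμ : ∀ j ≤ N, Integrable (fun s => (s - p) ^ j) μ)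
    (hν : ∀ j ≤ N, Integrable (fun s => (s - q) ^ j) ν) :
    ∀ j ≤ N, Integrable (fun s => (s - (p + q)) ^ j) (μ.conv ν) := by
  intro j hj
  rw [Measure.conv, integrable_map_measure (by fun_prop) (by fun_prop)]
  have h : ((fun s => (s - (p + q)) ^ j) ∘ fun z : ℝ × ℝ => z.1 + z.2) =
      fun z => ∑ i ∈ Finset.range (j + 1),
        (z.1 - p) ^ i * (z.2 - q) ^ (j - i) * (j.choose i : ℝ) := by
    ext z
    rw [← add_pow, Function.comp_apply]
    ring
  rw [h]
  refine integrable_finsetSum _ fun i hi => Integrable.mul_const ?_ _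
  rw [Finset.mem_range] at hi
  exact (hμ i (by omega)).mul_prod (hν (j - i) (by omega))

lemma integral_pow_conv {μ ν : Measure ℝ} [IsProbabilityMeasure μ] [IsProbabilityMeasure ν]
    {p q : ℝ} {N : ℕ} (hμ : ∀ j ≤ N, Integrable (fun s => (s - p) ^ j) μ)
    (hν : ∀ j ≤ N, Integrable (fun s => (s - q) ^ j) ν) (j : ℕ) (hj : j ≤ N) :
    ∫ s, (s - (p + q)) ^ j ∂(μ.conv ν) = ∑ i ∈ Finset.range (j + 1),
      (∫ s, (s - p) ^ i ∂μ) * (∫ s, (s - q) ^ (j - i) ∂ν) * (j.choose i : ℝ) := by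
  rw [Measure.conv, integral_map (by fun_prop) (by fun_prop)]
  have h : (fun z : ℝ × ℝ => (z.1 + z.2 - (p + q)) ^ j) =
      fun z => ∑ i ∈ Finset.range (j + 1),
        (z.1 - p) ^ i * (z.2 - q) ^ (j - i) * (j.choose i : ℝ) := by
    ext z
    rw [← add_pow]
    ring
  rw [h, integral_finsetSum]
  · refine Finset.sum_congr rfl fun i _ => ?_
    rw [integral_mul_const, ← integral_prod_mul]
  · intro i hi
    rw [Finset.mem_range] at hi
    exact ((hμ i (by omega)).mul_prod (hν (j - i) (by omega))).mul_const _

lemma integrable_pow_convPow {ν : Measure ℝ} [IsProbabilityMeasure ν] {N : ℕ}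
    (hν : ∀ j ≤ N, Integrable (fun s => (s - 1) ^ j) ν) (n : ℕ) :
    ∀ j ≤ N, Integrable (fun s : ℝ => (s - n) ^ j) (convPow ν n) := by
  induction n with
  | zero => exact fun j _ => integrable_dirac (by simp)
  | succ n ih =>
    rw [Nat.cast_succ]
    exact integrable_pow_conv ih hν

lemma moments_convPow {ν : Measure ℝ} [IsProbabilityMeasure ν]
    (hν : ∀ j ≤ 4, Integrable (fun s => (s - 1) ^ j) ν) (hmean : ∫ s, (s - 1) ∂ν = 0) (n : ℕ) :
    ∫ s, (s - n) ∂(convPow ν n) = 0 ∧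
    ∫ s, (s - n) ^ 2 ∂(convPow ν n) = n * ∫ s, (s - 1) ^ 2 ∂ν ∧
    ∫ s, (s - n) ^ 4 ∂(convPow ν n) =
      n * (∫ s, (s - 1) ^ 4 ∂ν) + 3 * n * (n - 1) * (∫ s, (s - 1) ^ 2 ∂ν) ^ 2 := by
  induction n with
  | zero => simp [convPow]
  | succ n ih =>
    obtain ⟨h1, h2, h4⟩ := ih
    have key := integral_pow_conv (integrable_pow_convPow hν n) hν
    have k1 := key 1 (by norm_num)
    have k2 := key 2 (by norm_num)
    have k4 := key 4 le_rfl
    simp only [Finset.sum_range_succ, Finset.sum_range_zero, pow_one, pow_zero, Nat.sub_zero,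
      Nat.sub_self, Nat.choose, Nat.reduceSub, Nat.reduceAdd, integral_const, probReal_univ,
      smul_eq_mul, h1, h2, h4, hmean, Nat.cast_one] at k1 k2 k4
    simp only [convPow, Nat.cast_succ]
    refine ⟨by rw [k1]; ring, by rw [k2]; push_cast; ring, by rw [k4]; push_cast; ring⟩

lemma integrable_pow_of_integrable_pow_four {μ : Measure ℝ} [IsFiniteMeasure μ] {f : ℝ → ℝ}
    (hf : Continuous f) (h : Integrable (fun s => f s ^ 4) μ) :
    ∀ j ≤ 4, Integrable (fun s => f s ^ j) μ := by
  intro j hj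
  refine ((integrable_const (1 : ℝ)).add h).mono' (by fun_prop) (Eventually.of_forall fun s => ?_)
  have h4 : f s ^ 4 = |f s| ^ 4 := (Even.pow_abs (by decide) _).symm
  simp only [Pi.add_apply, norm_pow, norm_eq_abs]
  rw [h4]
  rcases le_total |f s| 1 with h1 | h1
  · linarith [pow_le_one₀ (n := j) (abs_nonneg (f s)) h1, pow_nonneg (abs_nonneg (f s)) 4]
  · linarith [pow_le_pow_right₀ h1 hj]

lemma integrable_sub_pow_four {μ : Measure ℝ} [IsFiniteMeasure μ] (a : ℝ)
    (h : Integrable (fun s => s ^ 4) μ) : Integrable (fun s => (s - a) ^ 4) μ := by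
  refine ((h.add (integrable_const (a ^ 4))).const_mul 8).mono' (by fun_prop)
    (Eventually.of_forall fun s => ?_)
  rw [norm_of_nonneg (by positivity)]
  simp only [Pi.add_apply]
  nlinarith [sq_nonneg (s + a), sq_nonneg (s - a), sq_nonneg ((s - a) ^ 2),
    sq_nonneg (s ^ 2 - a ^ 2), mul_nonneg (sq_nonneg (s - a)) (sq_nonneg (s + a))]

/-- Cauchy–Schwarz for the second, third and fourth absolute moments. -/
lemma sq_integral_abs_pow_three_le {μ : Measure ℝ} [IsFiniteMeasure μ] {f : ℝ → ℝ}
    (hf : Continuous f) (h : Integrable (fun s => f s ^ 4) μ) :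
    (∫ s, |f s| ^ 3 ∂μ) ^ 2 ≤ (∫ s, f s ^ 2 ∂μ) * ∫ s, f s ^ 4 ∂μ := by
  have h2 := integrable_pow_of_integrable_pow_four hf h 2 (by norm_num)
  have h3 : Integrable (fun s => |f s| ^ 3) μ := by
    simpa using (integrable_pow_of_integrable_pow_four hf h 3 (by norm_num)).norm
  have := discrim_le_zero (a := ∫ s, f s ^ 2 ∂μ) (b := -2 * ∫ s, |f s| ^ 3 ∂μ)
    (c := ∫ s, f s ^ 4 ∂μ) fun c => by
      have e : (∫ s, f s ^ 2 ∂μ) * (c * c) + -2 * (∫ s, |f s| ^ 3 ∂μ) * c + ∫ s, f s ^ 4 ∂μ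
          = ∫ s, (c * c * f s ^ 2 - 2 * c * |f s| ^ 3 + f s ^ 4) ∂μ := by
        rw [integral_add (integrable_fun_sub (h2.const_mul _) (h3.const_mul _)) h,
          integral_sub (h2.const_mul _) (h3.const_mul _), integral_const_mul, integral_const_mul]
        ring
      rw [e]
      refine integral_nonneg fun s => ?_
      have h2' : f s ^ 2 = |f s| ^ 2 := (sq_abs _).symm
      have h4' : f s ^ 4 = |f s| ^ 4 := (Even.pow_abs (by decide) _).symm
      simp only [Pi.zero_apply]
      rw [h2', h4']
      nlinarith [sq_nonneg (c * |f s| - |f s| ^ 2)]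
  unfold discrim at this
  linarith

lemma sq_variance_le_fourth_moment {μ : Measure ℝ} [IsProbabilityMeasure μ] {f : ℝ → ℝ}
    (hf : Continuous f) (h : Integrable (fun s => f s ^ 4) μ) :
    (∫ s, f s ^ 2 ∂μ) ^ 2 ≤ ∫ s, f s ^ 4 ∂μ := by
  have h2 := integrable_pow_of_integrable_pow_four hf h 2 (by norm_num)
  have h0 : 0 ≤ ∫ s, (f s ^ 2 - ∫ r, f r ^ 2 ∂μ) ^ 2 ∂μ := integral_nonneg fun s => sq_nonneg _
  have e : (fun s => (f s ^ 2 - ∫ r, f r ^ 2 ∂μ) ^ 2) = fun s =>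
      f s ^ 4 - 2 * (∫ r, f r ^ 2 ∂μ) * f s ^ 2 + (∫ r, f r ^ 2 ∂μ) ^ 2 := by
    ext s; ring
  rw [e, integral_add (integrable_fun_sub h (h2.const_mul _)) (integrable_const _),
    integral_sub h (h2.const_mul _), integral_const_mul, integral_const] at h0
  simp only [probReal_univ, smul_eq_mul] at h0
  linarith

lemma integral_sub_one_sq {ν : Measure ℝ} [IsProbabilityMeasure ν]
    (h1 : Integrable (fun s => s) ν) (h2 : Integrable (fun s => s ^ 2) ν)
    (hmean : ∫ s, s ∂ν = 1) : ∫ s, (s - 1) ^ 2 ∂ν = (∫ s, s ^ 2 ∂ν) - 1 := by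
  have e : (fun s : ℝ => (s - 1) ^ 2) = fun s => s ^ 2 - 2 * s + 1 := by ext s; ring
  rw [e, integral_add (integrable_fun_sub h2 (h1.const_mul _)) (integrable_const _),
    integral_sub h2 (h1.const_mul _), integral_const_mul, hmean]
  simp only [integral_const, probReal_univ, smul_eq_mul]
  ring

/-- For nonnegative variables of mean one, the fourth moment decreases by at least one
under centering. -/
lemma integral_sub_one_pow_four_le {ν : Measure ℝ} [IsProbabilityMeasure ν]
    (hν : ∀ᵐ s ∂ν, 0 ≤ s) (h1 : Integrable (fun s => s - 1) ν) (hmean : ∫ s, (s - 1) ∂ν = 0)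
    (h4 : Integrable (fun s => s ^ 4) ν) :
    ∫ s, (s - 1) ^ 4 ∂ν ≤ (∫ s, s ^ 4 ∂ν) - 1 := by
  have i : Integrable (fun s : ℝ => s ^ 4 - 1) ν := h4.sub (integrable_const _)
  have e : (∫ s, s ^ 4 ∂ν) - 1 = ∫ s, (s ^ 4 - 1 - 4 * (s - 1)) ∂ν := by
    rw [integral_sub i (h1.const_mul 4), integral_sub h4 (integrable_const _),
      integral_const_mul, hmean]
    simp
  rw [e]
  refine integral_mono_ae (integrable_sub_pow_four 1 h4) (i.sub (h1.const_mul 4)) ?_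
  filter_upwards [hν] with s hs
  nlinarith [mul_nonneg hs (sq_nonneg (s - 1)), sq_nonneg (s - 1)]

lemma sq_integral_abs_pow_three_convPow_le {ν : Measure ℝ} [IsProbabilityMeasure ν]
    (h : Integrable (fun s => s ^ 4) ν) (hmean : ∫ s, (s - 1) ∂ν = 0) {n : ℕ} (hn : 0 < n) :
    (∫ s, |s - n| ^ 3 ∂(convPow ν n)) ^ 2 ≤
      3 * (n : ℝ) ^ 3 * ((∫ s, (s - 1) ^ 2 ∂ν) * ∫ s, (s - 1) ^ 4 ∂ν) := by
  have h4 := integrable_sub_pow_four 1 h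
  have hj := integrable_pow_of_integrable_pow_four (by fun_prop) h4
  have hv : 0 ≤ ∫ s, (s - 1) ^ 2 ∂ν := integral_nonneg fun s => sq_nonneg _
  have hm : 0 ≤ ∫ s, (s - 1) ^ 4 ∂ν := integral_nonneg fun s => by positivity
  have hvm := sq_variance_le_fourth_moment (by fun_prop) h4
  obtain ⟨-, e2, e4⟩ := moments_convPow hj hmean n
  refine (sq_integral_abs_pow_three_le (by fun_prop)
    (integrable_pow_convPow hj n 4 le_rfl)).trans ?_
  rw [e2, e4]
  have hn' : (1 : ℝ) ≤ n := by exact_mod_cast hn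
  generalize (n : ℝ) = r at *
  generalize (∫ s, (s - 1) ^ 2 ∂ν) = v at *
  generalize (∫ s, (s - 1) ^ 4 ∂ν) = m at *
  have h1 : 3 * r * (r - 1) * v ^ 2 ≤ 3 * r * (r - 1) * m :=
    mul_le_mul_of_nonneg_left hvm (mul_nonneg (by linarith) (by linarith))
  have h2 : r * m + 3 * r * (r - 1) * v ^ 2 ≤ 3 * r ^ 2 * m := by
    nlinarith [mul_nonneg (by linarith : 0 ≤ r) hm]
  calc r * v * (r * m + 3 * r * (r - 1) * v ^ 2) ≤ r * v * (3 * r ^ 2 * m) :=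
        mul_le_mul_of_nonneg_left h2 (mul_nonneg (by linarith) hv)
    _ = _ := by ring

lemma norm_integral_le_pow {E : Type*} [NormedAddCommGroup E] [NormedSpace ℝ E] {f : ℝ → E}
    {a b C : ℝ} {n : ℕ} (h : ∀ v ∈ uIoc a b, ‖f v‖ ≤ C * |v - a| ^ n) :
    ‖∫ v in a..b, f v‖ ≤ C * (|b - a| ^ (n + 1) / (n + 1)) := by
  rw [intervalIntegral.norm_intervalIntegral_eq, ← integral_pow_abs_sub_uIoc,
    ← integral_const_mul]
  refine norm_integral_le_of_norm_le ?_ ?_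
  · have : Continuous fun v : ℝ => C * |v - a| ^ n := by fun_prop
    exact (this.intervalIntegrable a b).def'
  · exact (ae_restrict_iff' measurableSet_uIoc).2 (Eventually.of_forall h)

lemma sub_eq_neg_intervalIntegral {E : Type*} [NormedAddCommGroup E] [NormedSpace ℝ E] {f g : ℝ → E}
    {y : E} (hg : Continuous g) (hf : ∀ u, 0 ≤ u → f u = y - ∫ v in (0 : ℝ)..u, g v)
    {t u : ℝ} (ht : 0 ≤ t) (hu : 0 ≤ u) : f u - f t = -∫ v in t..u, g v := by
  rw [hf u hu, hf t ht, ← intervalIntegral.integral_interval_sub_left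
    (hg.intervalIntegrable 0 u) (hg.intervalIntegrable 0 t)]
  abel

lemma norm_taylor_le {E : Type*} [NormedAddCommGroup E] [NormedSpace ℝ E] [CompleteSpace E]
    {f₀ f₁ f₂ f₃ : ℝ → E}
    (c₁ : Continuous f₁) (c₂ : Continuous f₂) (c₃ : Continuous f₃) {x y₁ y₂ : E}
    (h₀ : ∀ u, 0 ≤ u → f₀ u = x - ∫ v in (0 : ℝ)..u, f₁ v)
    (h₁ : ∀ u, 0 ≤ u → f₁ u = y₁ - ∫ v in (0 : ℝ)..u, f₂ v)
    (h₂ : ∀ u, 0 ≤ u → f₂ u = y₂ - ∫ v in (0 : ℝ)..u, f₃ v)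
    {C : ℝ} (hC : ∀ u, ‖f₃ u‖ ≤ C) {t u : ℝ} (ht : 0 ≤ t) (hu : 0 ≤ u) :
    ‖f₀ u - f₀ t + (u - t) • f₁ t - ((u - t) ^ 2 / 2) • f₂ t‖ ≤ C * |u - t| ^ 3 / 6 := by
  have pos : ∀ {u v : ℝ}, 0 ≤ u → v ∈ uIoc t u → 0 ≤ v := fun hu hv =>
    (le_min ht hu).trans hv.1.le
  have b₂ : ∀ u, 0 ≤ u → ‖f₂ u - f₂ t‖ ≤ C * |u - t| ^ 1 := by
    intro u hu
    rw [sub_eq_neg_intervalIntegral c₃ h₂ ht hu, norm_neg]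
    refine (norm_integral_le_pow (n := 0) (C := C) fun v _ => ?_).trans (by simp)
    simpa using hC v
  have b₁ : ∀ u, 0 ≤ u → ‖f₁ u - f₁ t + (u - t) • f₂ t‖ ≤ C / 2 * |u - t| ^ 2 := by
    intro u hu
    have e : f₁ u - f₁ t + (u - t) • f₂ t = -∫ v in t..u, (f₂ v - f₂ t) := by
      rw [intervalIntegral.integral_sub (c₂.intervalIntegrable _ _) (by simp),
        intervalIntegral.integral_const, sub_eq_neg_intervalIntegral c₂ h₁ ht hu]
      abel
    rw [e, norm_neg]
    refine (norm_integral_le_pow (n := 1) fun v hv => b₂ v (pos hu hv)).trans (le_of_eq ?_)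
    norm_num
    ring
  have e : f₀ u - f₀ t + (u - t) • f₁ t - ((u - t) ^ 2 / 2) • f₂ t =
      -∫ v in t..u, (f₁ v - f₁ t + (v - t) • f₂ t) := by
    have i₁ : IntervalIntegrable (fun v => f₁ v - f₁ t) volume t u :=
      Continuous.intervalIntegrable (by fun_prop) _ _
    have i₂ : IntervalIntegrable (fun v => (v - t) • f₂ t) volume t u :=
      Continuous.intervalIntegrable (by fun_prop) _ _
    have i₃ : ∫ v in t..u, (v - t) = (u - t) ^ 2 / 2 := by
      rw [intervalIntegral.integral_comp_sub_right (fun v => v)]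
      simp
    rw [intervalIntegral.integral_add i₁ i₂, intervalIntegral.integral_smul_const, i₃,
      intervalIntegral.integral_sub (c₁.intervalIntegrable _ _) (by simp),
      intervalIntegral.integral_const, sub_eq_neg_intervalIntegral c₁ h₀ ht hu]
    abel
  rw [e, norm_neg]
  refine (norm_integral_le_pow (n := 2) fun v hv => b₁ v (pos hu hv)).trans (le_of_eq ?_)
  norm_num
  ring

section Semigroup

variable {X : Type*} [NormedAddCommGroup X] [NormedSpace ℂ X]

lemma integrable_orbit {S : ℝ → X →L[ℂ] X} {M : ℝ} (hS : ∀ x, Continuous fun u => S u x)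
    (hM : ∀ u, ‖S u‖ ≤ M) {α : Type*} [TopologicalSpace α] [MeasurableSpace α]
    [OpensMeasurableSpace α] [SecondCountableTopology α] {μ : Measure α} [IsFiniteMeasure μ]
    {φ : α → ℝ} (hφ : Continuous φ) (x : X) : Integrable (fun a => S (φ a) x) μ := by
  refine (integrable_const (M * ‖x‖)).mono'
    ((hS x).comp hφ).aestronglyMeasurable ?_
  exact Eventually.of_forall fun a => (S (φ a)).le_of_opNorm_le (hM _) x

variable [CompleteSpace X]

/-- The iterates of a subordinated operator are the subordinated operators of the
convolution powers. -/
lemma iterate_eq_integral_convPow {S : ℝ → X →L[ℂ] X} {M : ℝ} (h0 : S 0 = 1)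
    (hadd : ∀ s t : ℝ, 0 ≤ s → 0 ≤ t → S (s + t) = (S s).comp (S t))
    (hS : ∀ x, Continuous fun u => S u x) (hM : ∀ u, ‖S u‖ ≤ M)
    {ν : Measure ℝ} [IsProbabilityMeasure ν] (hν : ∀ᵐ s ∂ν, 0 ≤ s) {c : ℝ} (hc : 0 ≤ c)
    (n : ℕ) (x : X) :
    (fun v : X => ∫ s, S (c * s) v ∂ν)^[n] x = ∫ s, S (c * s) x ∂(convPow ν n) := by
  induction n with
  | zero => simp [convPow, h0]
  | succ n ih =>
    have hpow := ae_nonneg_convPow hν n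
    have hcont : Continuous fun s => S (c * s) x := (hS x).comp (by fun_prop)
    rw [Function.iterate_succ_apply', ih, convPow, Measure.conv,
      integral_map (by fun_prop) hcont.aestronglyMeasurable,
      integral_prod_symm _ (integrable_orbit hS hM (by fun_prop) x)]
    refine integral_congr_ae ?_
    filter_upwards [hν] with s hs
    rw [← ContinuousLinearMap.integral_comp_comm _ (integrable_orbit hS hM (by fun_prop) x)]
    refine integral_congr_ae ?_
    filter_upwards [hpow] with r hr
    rw [mul_add, add_comm, hadd _ _ (mul_nonneg hc hs) (mul_nonneg hc hr)]
    rfl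

lemma norm_integral_convPow_sub_le {S : ℝ → X →L[ℂ] X} {M : ℝ}
    (hS : ∀ x, Continuous fun u => S u x) (hM : ∀ u, ‖S u‖ ≤ M)
    {ν : Measure ℝ} [IsProbabilityMeasure ν] (hν : ∀ᵐ s ∂ν, 0 ≤ s)
    (h4 : Integrable (fun s => s ^ 4) ν) (hmean : ∫ s, (s - 1) ∂ν = 0) {x y₁ y₂ y₃ : X}
    (hx : ∀ u : ℝ, 0 ≤ u → S u x = x - ∫ v in (0:ℝ)..u, S v y₁)
    (hy₁ : ∀ u : ℝ, 0 ≤ u → S u y₁ = y₁ - ∫ v in (0:ℝ)..u, S v y₂)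
    (hy₂ : ∀ u : ℝ, 0 ≤ u → S u y₂ = y₂ - ∫ v in (0:ℝ)..u, S v y₃)
    {t : ℝ} (ht : 0 ≤ t) {n : ℕ} (hn : 0 < n) :
    ‖(∫ s, S (t / n * s) x ∂(convPow ν n)) - S t x
        - ((∫ s, (s - 1) ^ 2 ∂ν) * t ^ 2 / (2 * n)) • S t y₂‖
      ≤ M * ‖y₃‖ * (t / n) ^ 3 / 6 * ∫ s, |s - n| ^ 3 ∂(convPow ν n) := by
  have hn' : (0 : ℝ) < n := by exact_mod_cast hn
  have hj := integrable_pow_convPow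
    (integrable_pow_of_integrable_pow_four (by fun_prop) (integrable_sub_pow_four 1 h4)) n
  obtain ⟨e1, e2, -⟩ := moments_convPow
    (integrable_pow_of_integrable_pow_four (by fun_prop) (integrable_sub_pow_four 1 h4)) hmean n
  have hd : ∀ s : ℝ, t / n * s - t = t / n * (s - n) := fun s => by field_simp
  have i₀ : Integrable (fun s => S (t / n * s) x) (convPow ν n) :=
    integrable_orbit hS hM (by fun_prop) x
  have i₁ : Integrable (fun s : ℝ => (t / n * s - t) • S t y₁) (convPow ν n) := by
    simp_rw [hd]
    exact Integrable.smul_const (by simpa using (hj 1 (by norm_num)).const_mul (t / n)) _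
  have i₂ : Integrable (fun s : ℝ => ((t / n * s - t) ^ 2 / 2) • S t y₂) (convPow ν n) := by
    simp_rw [hd, mul_pow]
    exact (((hj 2 (by norm_num)).const_mul _).div_const _).smul_const _
  have e : (∫ s, S (t / n * s) x ∂(convPow ν n)) - S t x
        - ((∫ s, (s - 1) ^ 2 ∂ν) * t ^ 2 / (2 * n)) • S t y₂ =
      ∫ s, (S (t / n * s) x - S t x + (t / n * s - t) • S t y₁
        - ((t / n * s - t) ^ 2 / 2) • S t y₂) ∂(convPow ν n) := by
    rw [integral_sub ((integrable_fun_sub i₀ (integrable_const _)).fun_add i₁) i₂,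
      integral_add (integrable_fun_sub i₀ (integrable_const _)) i₁, integral_sub i₀ (integrable_const _),
      integral_smul_const, integral_smul_const]
    simp_rw [hd, mul_pow, mul_div_right_comm]
    rw [integral_const_mul, integral_const_mul, e1, e2]
    simp only [integral_const, probReal_univ, one_smul, mul_zero, zero_smul, add_zero]
    congr 2
    field_simp
  rw [e, ← integral_const_mul]
  refine norm_integral_le_of_norm_le ?_ ?_
  · refine Integrable.const_mul ?_ _
    simpa using (hj 3 (by norm_num)).norm
  · filter_upwards [ae_nonneg_convPow hν n] with s hs
    refine (norm_taylor_le (f₀ := fun u => S u x) (hS y₁) (hS y₂) (hS y₃) hx hy₁ hy₂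
      (fun u => (S u).le_of_opNorm_le (hM u) y₃) ht (by positivity)).trans (le_of_eq ?_)
    rw [hd, abs_mul, abs_of_nonneg (by positivity : 0 ≤ t / n)]
    ring

end Semigroup

theorem stmt_18
    {X : Type*} [NormedAddCommGroup X] [NormedSpace ℂ X] [CompleteSpace X]
    (T : ℝ → X →L[ℂ] X) (M : ℝ)
    (hT0 : T 0 = 1)
    (hTadd : ∀ s t : ℝ, 0 ≤ s → 0 ≤ t → T (s + t) = (T s).comp (T t))
    (hTcont : ∀ x : X, ContinuousOn (fun t => T t x) (Set.Ici 0))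
    (hM : ∀ t : ℝ, 0 ≤ t → ‖T t‖ ≤ M)
    (ν : ℝ → Measure ℝ)
    (hprob : ∀ t : ℝ, 0 < t → IsProbabilityMeasure (ν t))
    (hsupp : ∀ t : ℝ, 0 < t → (ν t) (Set.Iio 0) = 0)
    (hint1 : ∀ t : ℝ, 0 < t → Integrable (fun s => s) (ν t))
    (hmean : ∀ t : ℝ, 0 < t → (∫ s, s ∂(ν t)) = 1)
    (hint2 : ∀ t : ℝ, 0 < t → Integrable (fun s => s ^ 2) (ν t))
    (hint4 : ∀ t : ℝ, 0 < t → Integrable (fun s => s ^ 4) (ν t))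
    (x y₁ y₂ y₃ : X)
    (hx : ∀ u : ℝ, 0 ≤ u → T u x = x - ∫ v in (0:ℝ)..u, T v y₁)
    (hy₁ : ∀ u : ℝ, 0 ≤ u → T u y₁ = y₁ - ∫ v in (0:ℝ)..u, T v y₂)
    (hy₂ : ∀ u : ℝ, 0 ≤ u → T u y₂ = y₂ - ∫ v in (0:ℝ)..u, T v y₃) :
    ∀ t : ℝ, 0 < t → ∀ n : ℕ, 0 < n →
      ‖(fun v : X => ∫ s, T (t * s / n) v ∂(ν t))^[n] x - T t x
          - (((∫ s, s ^ 2 ∂(ν t)) - 1) * t ^ 2 / (2 * n)) • T t y₂‖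
        ≤ M * Real.sqrt (((∫ s, s ^ 2 ∂(ν t)) - 1) * ((∫ s, s ^ 4 ∂(ν t)) - 1) / 2)
            * t ^ 3 / (n:ℝ) ^ ((3:ℝ) / 2) * ‖y₃‖ := by
  intro t ht n hn
  have := hprob t ht
  have hν : ∀ᵐ s ∂(ν t), 0 ≤ s := by
    refine ae_iff.2 ?_
    simpa [Iio_def] using hsupp t ht
  have hn' : (0 : ℝ) < n := by exact_mod_cast hn
  have hc : 0 ≤ t / n := by positivity
  let S : ℝ → X →L[ℂ] X := fun u => T (max u 0)
  have hST : ∀ u, 0 ≤ u → S u = T u := fun u hu => by simp only [S, max_eq_left hu]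
  have hS : ∀ x, Continuous fun u => S u x := fun x =>
    (hTcont x).comp_continuous (by fun_prop) fun u => le_max_right u 0
  have hSM : ∀ u, ‖S u‖ ≤ M := fun u => hM _ (le_max_right u 0)
  have hSadd : ∀ s t : ℝ, 0 ≤ s → 0 ≤ t → S (s + t) = (S s).comp (S t) := fun s t hs ht => by
    rw [hST s hs, hST t ht, hST _ (add_nonneg hs ht), hTadd s t hs ht]
  have hrel : ∀ {z w : X}, (∀ u : ℝ, 0 ≤ u → T u z = z - ∫ v in (0:ℝ)..u, T v w) →
      ∀ u : ℝ, 0 ≤ u → S u z = z - ∫ v in (0:ℝ)..u, S v w := by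
    intro z w h u hu
    rw [hST u hu, h u hu]
    congr 1
    refine intervalIntegral.integral_congr fun v hv => ?_
    rw [uIcc_of_le hu] at hv
    simp only [hST v hv.1]
  have hiter : (fun v : X => ∫ s, T (t * s / n) v ∂(ν t)) =
      fun v : X => ∫ s, S (t / n * s) v ∂(ν t) := by
    ext v
    refine integral_congr_ae ?_
    filter_upwards [hν] with s hs
    rw [hST _ (mul_nonneg hc hs), mul_div_right_comm]
  have hmean₀ : ∫ s, (s - 1) ∂(ν t) = 0 := by
    rw [integral_sub (hint1 t ht) (integrable_const _), hmean t ht]; simp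
  have hbound := norm_integral_convPow_sub_le hS hSM hν (hint4 t ht) hmean₀
    (hrel hx) (hrel hy₁) (hrel hy₂) ht.le hn
  have hB := sq_integral_abs_pow_three_convPow_le (hint4 t ht) hmean₀ hn
  have hm := integral_sub_one_pow_four_le hν ((hint1 t ht).sub (integrable_const _)) hmean₀ (hint4 t ht)
  have hm0 : 0 ≤ ∫ s, (s - 1) ^ 4 ∂(ν t) := integral_nonneg fun s => by positivity
  have hv0 : 0 ≤ ∫ s, (s - 1) ^ 2 ∂(ν t) := integral_nonneg fun s => by positivity
  have hM0 : 0 ≤ M := (norm_nonneg _).trans (hM 0 le_rfl)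
  rw [hiter, iterate_eq_integral_convPow (by rw [hST 0 le_rfl, hT0]) hSadd hS hSM hν hc,
    ← hST t ht.le, ← integral_sub_one_sq (hint1 t ht) (hint2 t ht) (hmean t ht)]
  refine hbound.trans ?_
  generalize (∫ s, |s - n| ^ 3 ∂(convPow (ν t) n)) = B at *
  generalize (∫ s, (s - 1) ^ 2 ∂(ν t)) = v at *
  generalize (∫ s, (s - 1) ^ 4 ∂(ν t)) = m at *
  generalize (∫ s, s ^ 4 ∂(ν t)) = m₄ at *
  have hvm : 0 ≤ v * (m₄ - 1) := mul_nonneg hv0 (hm0.trans hm)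
  have hN0 : 0 < (n : ℝ) ^ ((3 : ℝ) / 2) := rpow_pos_of_pos hn' _
  have hN : ((n : ℝ) ^ ((3 : ℝ) / 2)) ^ 2 = (n : ℝ) ^ 3 := by
    rw [← rpow_natCast, ← rpow_mul hn'.le, ← rpow_natCast]
    norm_num
  generalize (n : ℝ) ^ ((3 : ℝ) / 2) = N at *
  have hle : B / 6 ≤ √(v * (m₄ - 1) / 2) * N := by
    refine le_of_sq_le_sq ?_ (by positivity)
    rw [mul_pow, sq_sqrt (by linarith), hN]
    have : (n : ℝ) ^ 3 * (v * m) ≤ (n : ℝ) ^ 3 * (v * (m₄ - 1)) := by gcongr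
    have : 0 ≤ (n : ℝ) ^ 3 * (v * (m₄ - 1)) := by positivity
    linarith
  calc M * ‖y₃‖ * (t / n) ^ 3 / 6 * B = M * ‖y₃‖ * (t / n) ^ 3 * (B / 6) := by ring
    _ ≤ M * ‖y₃‖ * (t / n) ^ 3 * (√(v * (m₄ - 1) / 2) * N) := by gcongr
    _ = M * √(v * (m₄ - 1) / 2) * t ^ 3 / N * ‖y₃‖ := by
      rw [div_pow, ← hN]
      field_simp
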